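/- Let 𝒢 be a closed subgroup of Sym(P) with Aut(P) ⊆ 𝒢, let c₁, …, cₙ ∈ P, and let g : P → P be canonical from (P, c₁, …, cₙ) to P and M-generated by 𝒢. Then either 𝒢 = Sym(P), or g behaves like id on every infinite orbit of (P, c₁, …, cₙ), or g behaves like ↕ on every infinite orbit of (P, c₁, …, cₙ). -/

import Mathlib

variable {P : Type} [PartialOrder P]

/-- `a` and `b` are incomparable elements of the partial order `P`. -/
def Perp (a b : P) : Prop := ¬ a ≤ b ∧ ¬ b ≤ a

/-- `f` is an order-automorphism of `P`. -/
def IsOrderAuto (f : Equiv.Perm P) : Prop := ∀ a b : P, f a ≤ f b ↔ a ≤ b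

/-- `f` is an anti-automorphism of `P`. -/
def IsAntiAuto (f : Equiv.Perm P) : Prop := ∀ a b : P, f a ≤ f b ↔ b ≤ a

/-- Every finite partial order embeds into `P` (universality). -/
def IsUniversal (P : Type) [PartialOrder P] : Prop :=
  ∀ (Q : Type) [PartialOrder Q] [Fintype Q], Nonempty (Q ↪o P)

/-- Every order-isomorphism between two finite subsets of `P` extends to an
order-automorphism of `P` (homogeneity). -/
def IsHomogeneous (P : Type) [PartialOrder P] : Prop :=
  ∀ (S T : Finset P) (e : (S : Set P) ≃o (T : Set P)),
    ∃ g : P ≃o P, ∀ x : (S : Set P), g ↑x = ↑(e x)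

/-- A subgroup of `Sym(P)` is closed iff it contains every permutation that agrees
with one of its members on each finite subset of `P`. -/
def IsClosedSubgroup (G : Subgroup (Equiv.Perm P)) : Prop :=
  ∀ f : Equiv.Perm P,
    (∀ S : Finset P, ∃ g ∈ G, ∀ x ∈ S, (g : Equiv.Perm P) x = f x) → f ∈ G

/-- `h` is an order-automorphism of `P` fixing each of the constants `c i`. -/
def FixingAuto (n : ℕ) (c : Fin n → P) (h : Equiv.Perm P) : Prop :=
  IsOrderAuto h ∧ ∀ i : Fin n, h (c i) = c i

/-- `X` is an orbit of `(P, c₁, …, cₙ)`, i.e. an orbit of the action on `P` of the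
group of automorphisms of `P` fixing each `c i`. -/
def IsOrbit (n : ℕ) (c : Fin n → P) (X : Set P) : Prop :=
  ∃ x : P, X = {y | ∃ h : Equiv.Perm P, FixingAuto n c h ∧ h x = y}

/-- `g` is canonical as a function from `(P, c₁, …, cₙ)` to `P`. -/
def Canonical (n : ℕ) (c : Fin n → P) (g : P → P) : Prop :=
  ∀ (m : ℕ) (a b : Fin m → P),
    (∃ h : Equiv.Perm P, FixingAuto n c h ∧ ∀ j : Fin m, h (a j) = b j) →
    ∃ h' : Equiv.Perm P, IsOrderAuto h' ∧ ∀ j : Fin m, h' (g (a j)) = g (b j)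

/-- `g` is M-generated by the subgroup `G` of `Sym(P)`: on every finite subset of `P`
it agrees with some member of `G`. -/
def MGen (G : Subgroup (Equiv.Perm P)) (g : P → P) : Prop :=
  ∀ S : Finset P, ∃ h ∈ G, ∀ x ∈ S, (h : Equiv.Perm P) x = g x

/-- `g` behaves like `id` on `X`. -/
def BehavesLikeId (g : P → P) (X : Set P) : Prop :=
  ∀ x ∈ X, ∀ x' ∈ X, (x < x' → g x < g x') ∧ (Perp x x' → Perp (g x) (g x'))

/-- `g` behaves like `↕` on `X`. -/
def BehavesLikeRev (g : P → P) (X : Set P) : Prop :=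
  ∀ x ∈ X, ∀ x' ∈ X, (x < x' → g x' < g x) ∧ (Perp x x' → Perp (g x) (g x'))

/-- `g` behaves like `id` between `X` and `Y`. -/
def BehavesLikeIdBetween (g : P → P) (X Y : Set P) : Prop :=
  ∀ x ∈ X, ∀ y ∈ Y,
    (x < y → g x < g y) ∧ (y < x → g y < g x) ∧ (Perp x y → Perp (g x) (g y))

/-- `X ≤ Y` for subsets: some element of `X` lies below some element of `Y`. -/
def SetLE (X Y : Set P) : Prop := ∃ x ∈ X, ∃ y ∈ Y, x ≤ y

/-- `X < Y` for subsets: every element of `X` lies strictly below every element of `Y`. -/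
def SetLT (X Y : Set P) : Prop := ∀ x ∈ X, ∀ y ∈ Y, x < y

/-- The relation `X ÷ Y`. -/
def SetDiv (X Y : Set P) : Prop :=
  (SetLE X Y ∧ ¬ SetLE Y X ∧ ¬ SetLT X Y) ∨ (SetLE Y X ∧ ¬ SetLE X Y ∧ ¬ SetLT Y X)

/-- `f` is a rotation of `P`. -/
def IsRotation (f : Equiv.Perm P) : Prop :=
  ∃ X Y Z : Set P,
    (∀ p : P, p ∈ X ∨ p ∈ Y ∨ p ∈ Z) ∧
    Disjoint X Y ∧ Disjoint X Z ∧ Disjoint Y Z ∧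
    IsLowerSet X ∧ IsUpperSet Z ∧
    (∀ x ∈ X, ∀ z ∈ Z, x < z) ∧
    BehavesLikeId (⇑f) X ∧ BehavesLikeId (⇑f) Y ∧ BehavesLikeId (⇑f) Z ∧
    (∀ x ∈ X, ∀ z ∈ Z, f z < f x) ∧
    (∀ x ∈ X, ∀ y ∈ Y, (f y < f x ↔ Perp x y) ∧ (Perp (f x) (f y) ↔ x < y)) ∧
    (∀ y ∈ Y, ∀ z ∈ Z, (f z < f y ↔ Perp y z) ∧ (Perp (f y) (f z) ↔ y < z))

/-- The ternary relation `Cyc`. -/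
def Cyc (a b c : P) : Prop :=
  (a < b ∧ b < c) ∨ (b < c ∧ c < a) ∨ (c < a ∧ a < b) ∨
  (a < b ∧ Perp c a ∧ Perp c b) ∨ (b < c ∧ Perp a b ∧ Perp a c) ∨
  (c < a ∧ Perp b a ∧ Perp b c)

/-- The ternary relation `Cyc'`, the dual of `Cyc`. -/
def Cyc' (a b c : P) : Prop := Cyc c b a

/-- The ternary relation `Pari`. -/
def Pari (a b c : P) : Prop :=
  (Perp a b ∧ Perp b c ∧ Perp a c) ∨
  (a < b ∧ a < c ∧ Perp b c) ∨ (b < a ∧ b < c ∧ Perp a c) ∨ (c < a ∧ c < b ∧ Perp a b) ∨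
  (b < a ∧ c < a ∧ Perp b c) ∨ (a < b ∧ c < b ∧ Perp a c) ∨ (a < c ∧ b < c ∧ Perp a b)

/-- `f` preserves the ternary relation `R`. -/
def Preserves3 (f : P → P) (R : P → P → P → Prop) : Prop :=
  ∀ a b c : P, R a b c ↔ R (f a) (f b) (f c)

/-- Some member of `G` sends the tuple `a` to the tuple `b`. -/
def TupleSim (G : Subgroup (Equiv.Perm P)) {ι : Type} (a b : ι → P) : Prop :=
  ∃ h ∈ G, ∀ i, (h : Equiv.Perm P) (a i) = b i

namespace TupleSim

variable {α : Type} {G : Subgroup (Equiv.Perm α)} {ι : Type} {a b d : ι → α}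

theorem symm (h : TupleSim G a b) : TupleSim G b a := by
  obtain ⟨f, hf, hab⟩ := h
  exact ⟨f⁻¹, G.inv_mem hf, fun i => by rw [← hab i]; simp⟩

theorem trans (h : TupleSim G a b) (h' : TupleSim G b d) : TupleSim G a d := by
  obtain ⟨f, hf, hab⟩ := h
  obtain ⟨f', hf', hbd⟩ := h'
  exact ⟨f' * f, G.mul_mem hf' hf, fun i => by simp [hab, hbd]⟩

theorem injective (h : TupleSim G a b) (ha : Function.Injective a) : Function.Injective b := by
  obtain ⟨f, -, hab⟩ := h
  intro i j hij
  rw [← hab i, ← hab j] at hij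
  exact ha (f.injective hij)

end TupleSim

theorem IsHomogeneous.exists_isOrderAuto (hH : IsHomogeneous P) {ι : Type} [Finite ι]
    {u v : ι → P} (huv : ∀ i j, u i ≤ u j ↔ v i ≤ v j) :
    ∃ h : Equiv.Perm P, IsOrderAuto h ∧ ∀ i, h (u i) = v i := by
  classical
  have := Fintype.ofFinite ι
  have huv' : ∀ i j, u i = u j ↔ v i = v j := fun i j => by
    rw [le_antisymm_iff, le_antisymm_iff, huv, huv]
  have hu : ∀ s : ((Finset.univ.image u : Finset P) : Set P), ∃ i, u i = s := fun s => by
    simpa using s.2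
  have hv : ∀ s : ((Finset.univ.image v : Finset P) : Set P), ∃ i, v i = s := fun s => by
    simpa using s.2
  choose p hp using hu
  choose q hq using hv
  let e : ((Finset.univ.image u : Finset P) : Set P) ≃o
      ((Finset.univ.image v : Finset P) : Set P) :=
    { toFun := fun s => ⟨v (p s), by simp⟩
      invFun := fun s => ⟨u (q s), by simp⟩
      left_inv := fun s => by
        apply Subtype.ext
        rw [← hp s]
        exact (huv' _ _).2 (hq _)
      right_inv := fun s => by
        apply Subtype.ext
        rw [← hq s]
        exact (huv' _ _).1 (hp _)
      map_rel_iff' := fun {s t} => by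
        change v (p s) ≤ v (p t) ↔ (s : P) ≤ t
        rw [← huv, hp, hp] }
  obtain ⟨f, hf⟩ := hH _ _ e
  refine ⟨f.toEquiv, fun a b => f.le_iff_le, fun i => ?_⟩
  have h1 := hf ⟨u i, by simp⟩
  refine h1.trans ((huv' _ _).1 (hp _))

theorem IsHomogeneous.tupleSim (hH : IsHomogeneous P) {G : Subgroup (Equiv.Perm P)}
    (hAut : ∀ f : Equiv.Perm P, IsOrderAuto f → f ∈ G) {ι : Type} [Finite ι]
    {a b : ι → P} (hab : ∀ i j, a i ≤ a j ↔ b i ≤ b j) : TupleSim G a b := by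
  obtain ⟨h, hh, hab⟩ := hH.exists_isOrderAuto hab
  exact ⟨h, hAut h hh, hab⟩

theorem MGen.tupleSim {α : Type} {G : Subgroup (Equiv.Perm α)} {g : α → α} (hM : MGen G g) {ι : Type}
    [Finite ι] (a : ι → α) : TupleSim G a (g ∘ a) := by
  classical
  have := Fintype.ofFinite ι
  obtain ⟨h, hG, hh⟩ := hM (Finset.univ.image a)
  exact ⟨h, hG, fun i => hh _ (by simp)⟩

theorem MGen.injective {α : Type} {G : Subgroup (Equiv.Perm α)} {g : α → α} (hM : MGen G g) :
    Function.Injective g := by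
  classical
  intro x y hxy
  obtain ⟨h, -, hh⟩ := hM {x, y}
  apply h.injective
  rw [hh x (by simp), hh y (by simp), hxy]

/-- A closed subgroup that acts transitively on injective tuples is the full symmetric group. -/
theorem IsClosedSubgroup.eq_top {α : Type} {G : Subgroup (Equiv.Perm α)} (hG : IsClosedSubgroup G)
    (h : ∀ (ι : Type) [Finite ι] (a b : ι → α), Function.Injective a → Function.Injective b →
      TupleSim G a b) : G = ⊤ := by
  refine (Subgroup.eq_top_iff' G).2 fun f => hG f fun S => ?_
  obtain ⟨k, hk, hkf⟩ := h S (fun s => s) (fun s => f s) Subtype.val_injective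
    (f.injective.comp Subtype.val_injective)
  exact ⟨k, hk, fun x hx => hkf ⟨x, hx⟩⟩

/-- `u` and `v` lie in the same way relative to the constants `c`. -/
def SameType {n : ℕ} (c : Fin n → P) (u v : P) : Prop :=
  ∀ k, (c k ≤ u ↔ c k ≤ v) ∧ (u ≤ c k ↔ v ≤ c k)

theorem Canonical.le_iff {n : ℕ} {c : Fin n → P} {g : P → P} (hcan : Canonical n c g)
    (hH : IsHomogeneous P) {x y x' y' : P} (hx : SameType c x x') (hy : SameType c y y')
    (hxy : x ≤ y ↔ x' ≤ y') (hyx : y ≤ x ↔ y' ≤ x') :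
    (g x ≤ g y ↔ g x' ≤ g y') ∧ (g y ≤ g x ↔ g y' ≤ g x') := by
  have key : ∀ i j, Sum.elim c ![x, y] i ≤ Sum.elim c ![x, y] j ↔
      Sum.elim c ![x', y'] i ≤ Sum.elim c ![x', y'] j := by
    rintro (i | i) (j | j)
    · rfl
    · fin_cases j
      exacts [(hx i).1, (hy i).1]
    · fin_cases i
      exacts [(hx j).2, (hy j).2]
    · fin_cases i <;> fin_cases j <;> simp [hxy, hyx]
  obtain ⟨h, hh, hhe⟩ := hH.exists_isOrderAuto key
  obtain ⟨h', hh', hhe'⟩ := hcan 2 ![x, y] ![x', y']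
    ⟨h, ⟨hh, fun i => hhe (Sum.inl i)⟩, fun j => hhe (Sum.inr j)⟩
  have h0 : h' (g x) = g x' := hhe' 0
  have h1 : h' (g y) = g y' := hhe' 1
  rw [← h0, ← h1, hh', hh']
  exact ⟨Iff.rfl, Iff.rfl⟩

theorem IsUniversal.exists_preorder_embedding (hU : IsUniversal P) (κ : Type) [Finite κ]
    [Preorder κ] : ∃ f : κ → P, ∀ s t, f s ≤ f t ↔ s ≤ t := by
  have : Fintype (Antisymmetrization κ (· ≤ ·)) := @Fintype.ofFinite _ (Quotient.finite _)
  obtain ⟨e⟩ := hU (Antisymmetrization κ (· ≤ ·))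
  exact ⟨fun s => e (toAntisymmetrization (· ≤ ·) s), fun s t => by
    rw [e.le_iff_le, toAntisymmetrization_le_toAntisymmetrization_iff]⟩

/-- One-step extension property: a consistent finite preorder over the constants `c` is
realized in `P`. The elements `i` are prescribed to lie above the constants in `lo i` and below
those in `up i`. -/
theorem exists_realization (hU : IsUniversal P) (hH : IsHomogeneous P) {n : ℕ} (c : Fin n → P)
    {ι : Type} [Finite ι] [Preorder ι] (lo up : ι → Fin n → Prop)
    (lo_anti : ∀ i k l, c k ≤ c l → lo i l → lo i k)
    (up_mono : ∀ i k l, c k ≤ c l → up i k → up i l)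
    (le_of_lo_up : ∀ i k l, lo i k → up i l → c k ≤ c l)
    (lo_mono : ∀ i j k, i ≤ j → lo i k → lo j k)
    (up_anti : ∀ i j k, i ≤ j → up j k → up i k)
    (le_of_up_lo : ∀ i j k, up i k → lo j k → i ≤ j) :
    ∃ a : ι → P, (∀ i j, a i ≤ a j ↔ i ≤ j) ∧ (∀ i k, c k ≤ a i ↔ lo i k) ∧
      ∀ i k, a i ≤ c k ↔ up i k := by
  let R : Fin n ⊕ ι → Fin n ⊕ ι → Prop := fun s t =>
    Sum.elim (fun k => Sum.elim (fun l => c k ≤ c l) (fun i => lo i k) t)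
      (fun i => Sum.elim (fun l => up i l) (fun j => i ≤ j) t) s
  let pre : Preorder (Fin n ⊕ ι) :=
    { le := R
      lt := fun s t => R s t ∧ ¬ R t s
      lt_iff_le_not_ge := fun _ _ => Iff.rfl
      le_refl := by rintro (k | i) <;> simp [R]
      le_trans := by
        rintro (k | i) (l | j) (m | t) h1 h2 <;> simp only [R, Sum.elim_inl, Sum.elim_inr] at *
        · exact h1.trans h2
        · exact lo_anti _ _ _ h1 h2
        · exact le_of_lo_up _ _ _ h1 h2
        · exact lo_mono _ _ _ h2 h1
        · exact up_mono _ _ _ h2 h1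
        · exact le_of_up_lo _ _ _ h1 h2
        · exact up_anti _ _ _ h1 h2
        · exact h1.trans h2 }
  obtain ⟨f, hf⟩ := @IsUniversal.exists_preorder_embedding P _ hU (Fin n ⊕ ι) _ pre
  change ∀ s t, f s ≤ f t ↔ R s t at hf
  obtain ⟨h, hh, hhc⟩ := hH.exists_isOrderAuto (u := fun k => f (Sum.inl k)) (v := c)
    (fun k l => hf _ _)
  refine ⟨fun i => h (f (Sum.inr i)), fun i j => ?_, fun i k => ?_, fun i k => ?_⟩
  · rw [hh, hf]; rfl
  · rw [← hhc, hh, hf]; rfl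
  · rw [← hhc, hh, hf]; rfl

/-- Neither of `u`, `v` is a constant, and the constants allow elements of the type of `u` both
below and incomparable to elements of the type of `v`. -/
structure Separated {n : ℕ} (c : Fin n → P) (u v : P) : Prop where
  left_ne : ∀ k, u ≠ c k
  right_ne : ∀ k, v ≠ c k
  le_right : ∀ k, c k ≤ u → c k ≤ v
  left_le : ∀ k, v ≤ c k → u ≤ c k
  not_between : ∀ k, u ≤ c k → ¬ c k ≤ v

theorem Separated.refl {n : ℕ} {c : Fin n → P} {u : P} (hu : ∀ k, u ≠ c k) : Separated c u u :=
  ⟨hu, hu, fun _ => id, fun _ => id, fun k h h' => hu k (h.antisymm h')⟩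

/-- Any finite configuration can be placed with a prescribed lower set inside the type of `u`
and the rest inside the type of `v`. -/
theorem Separated.exists_tuple {n : ℕ} {c : Fin n → P} {u v : P} (huv : Separated c u v)
    (hU : IsUniversal P) (hH : IsHomogeneous P) {ι : Type} [Finite ι] (a : ι → P)
    (S : Set ι) (hS : ∀ i j, a i ≤ a j → j ∈ S → i ∈ S) :
    ∃ a' : ι → P, (∀ i j, a' i ≤ a' j ↔ a i ≤ a j) ∧ (∀ i ∈ S, SameType c (a' i) u) ∧
      ∀ i ∉ S, SameType c (a' i) v := by
  classical
  let w : ι → P := fun i => if i ∈ S then u else v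
  have hwS : ∀ i ∈ S, w i = u := fun i hi => if_pos hi
  have hwS' : ∀ i ∉ S, w i = v := fun i hi => if_neg hi
  let pre : Preorder ι := Preorder.lift a
  have hle : ∀ i j : ι, i ≤ j ↔ a i ≤ a j := fun i j => Iff.rfl
  obtain ⟨a', h1, h2, h3⟩ := exists_realization hU hH c (ι := ι) (fun i k => c k ≤ w i)
    (fun i k => w i ≤ c k) (fun i k l h h' => h.trans h') (fun i k l h h' => h'.trans h)
    (fun i k l h h' => h.trans h')
    (by
      intro i j k hij h
      by_cases hj : j ∈ S
      · rwa [hwS j hj, ← hwS i (hS i j hij hj)]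
      · rw [hwS' j hj]
        by_cases hi : i ∈ S
        · rw [hwS i hi] at h
          exact huv.le_right k h
        · rwa [hwS' i hi] at h)
    (by
      intro i j k hij h
      by_cases hj : j ∈ S
      · rwa [hwS i (hS i j hij hj), ← hwS j hj]
      · rw [hwS' j hj] at h
        by_cases hi : i ∈ S
        · rw [hwS i hi]
          exact huv.left_le k h
        · rwa [hwS' i hi])
    (by
      intro i j k h h'
      exfalso
      by_cases hi : i ∈ S <;> by_cases hj : j ∈ S
      · rw [hwS i hi] at h
        rw [hwS j hj] at h'
        exact huv.left_ne k (h.antisymm h')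
      · rw [hwS i hi] at h
        rw [hwS' j hj] at h'
        exact huv.not_between k h h'
      · rw [hwS' i hi] at h
        rw [hwS j hj] at h'
        exact huv.right_ne k (h.antisymm (huv.le_right k h'))
      · rw [hwS' i hi] at h
        rw [hwS' j hj] at h'
        exact huv.right_ne k (h.antisymm h'))
  refine ⟨a', h1, fun i hi k => ?_, fun i hi k => ?_⟩
  · rw [← hwS i hi]
    exact ⟨h2 i k, h3 i k⟩
  · rw [← hwS' i hi]
    exact ⟨h2 i k, h3 i k⟩

/-- `g` preserves the order among elements of the type of `u`. -/
def IdOnType {n : ℕ} (c : Fin n → P) (g : P → P) (u : P) : Prop :=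
  ∀ x x', SameType c x u → SameType c x' u → (g x ≤ g x' ↔ x ≤ x')

/-- `g` reverses the order among elements of the type of `u`. -/
def RevOnType {n : ℕ} (c : Fin n → P) (g : P → P) (u : P) : Prop :=
  ∀ x x', SameType c x u → SameType c x' u → (g x ≤ g x' ↔ x' ≤ x)

theorem exists_lt_of_sameType (hU : IsUniversal P) (hH : IsHomogeneous P) {n : ℕ}
    {c : Fin n → P} {u : P} (hu : ∀ k, u ≠ c k) :
    ∃ x y, SameType c x u ∧ SameType c y u ∧ x < y := by
  obtain ⟨e⟩ := hU (Fin 2)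
  obtain ⟨a, ha, haS, -⟩ := (Separated.refl hu).exists_tuple hU hH e Set.univ (by simp)
  refine ⟨a 0, a 1, haS 0 trivial, haS 1 trivial, ?_⟩
  rw [lt_iff_le_not_ge, ha, ha, e.le_iff_le, e.le_iff_le]
  decide

theorem SameType.symm {n : ℕ} {c : Fin n → P} {u v : P} (h : SameType c u v) :
    SameType c v u := fun k => ⟨(h k).1.symm, (h k).2.symm⟩

theorem SameType.trans {n : ℕ} {c : Fin n → P} {u v w : P} (h : SameType c u v)
    (h' : SameType c v w) : SameType c u w :=
  fun k => ⟨(h k).1.trans (h' k).1, (h k).2.trans (h' k).2⟩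

/-- On the type of a non-constant, `g` preserves or reverses the order, unless `G` is the full
symmetric group. -/
theorem idOnType_or_revOnType (hU : IsUniversal P) (hH : IsHomogeneous P)
    {G : Subgroup (Equiv.Perm P)} (hG : IsClosedSubgroup G)
    (hAut : ∀ f : Equiv.Perm P, IsOrderAuto f → f ∈ G) {n : ℕ} {c : Fin n → P} {g : P → P}
    (hcan : Canonical n c g) (hM : MGen G g) (hne : G ≠ ⊤) {u : P} (hu : ∀ k, u ≠ c k) :
    IdOnType c g u ∨ RevOnType c g u := by
  obtain ⟨x, y, hx, hy, hxy⟩ := exists_lt_of_sameType hU hH hu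
  have hlt : ∀ x' y', SameType c x' u → SameType c y' u → x' < y' →
      (g x' ≤ g y' ↔ g x ≤ g y) ∧ (g y' ≤ g x' ↔ g y ≤ g x) := fun x' y' hx' hy' h =>
    hcan.le_iff hH (hx'.trans hx.symm) (hy'.trans hy.symm)
      (iff_of_true h.le hxy.le) (iff_of_false h.not_ge hxy.not_ge)
  have hperp : ∀ x' y', SameType c x' u → SameType c y' u → ¬ x' ≤ y' → ¬ y' ≤ x' →
      ¬ g x' ≤ g y' := fun x' y' hx' hy' h h' hle => by
    have := (hcan.le_iff hH (hx'.trans hy'.symm) (hy'.trans hx'.symm)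
      (iff_of_false h h') (iff_of_false h' h)).1
    exact h (hM.injective (hle.antisymm (this.1 hle))).le
  have hgne : g x ≠ g y := fun h => hxy.ne (hM.injective h)
  by_cases h1 : g x ≤ g y
  · left
    have h2 : ¬ g y ≤ g x := fun h => hgne (h1.antisymm h)
    intro x' y' hx' hy'
    by_cases ha : x' ≤ y'
    · rcases ha.eq_or_lt with rfl | hb
      · simp
      · exact iff_of_true ((hlt x' y' hx' hy' hb).1.2 h1) ha
    · refine iff_of_false ?_ ha
      by_cases hb : y' ≤ x'
      · have hb' : y' < x' := lt_of_le_not_ge hb ha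
        exact fun h => h2 ((hlt y' x' hy' hx' hb').2.1 h)
      · exact hperp x' y' hx' hy' ha hb
  by_cases h2 : g y ≤ g x
  · right
    intro x' y' hx' hy'
    by_cases ha : y' ≤ x'
    · rcases ha.eq_or_lt with rfl | hb
      · simp
      · exact iff_of_true ((hlt y' x' hy' hx' hb).2.2 h2) ha
    · refine iff_of_false ?_ ha
      by_cases hb : x' ≤ y'
      · have hb' : x' < y' := lt_of_le_not_ge hb ha
        exact fun h => h1 ((hlt x' y' hx' hy' hb').1.1 h)
      · exact hperp x' y' hx' hy' hb ha
  exfalso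
  have hanti : ∀ (ι : Type) [Finite ι] (a : ι → P), Function.Injective a →
      ∃ b, TupleSim G a b ∧ ∀ i j, b i ≤ b j ↔ i = j := by
    intro ι _ a ha
    obtain ⟨a', ha', haS, -⟩ := (Separated.refl hu).exists_tuple hU hH a Set.univ (by simp)
    refine ⟨g ∘ a', (hH.tupleSim hAut fun i j => (ha' i j).symm).trans (hM.tupleSim a'),
      fun i j => ⟨fun hle => ?_, fun h => h ▸ le_rfl⟩⟩
    have hi := haS i trivial
    have hj := haS j trivial
    by_contra hij
    have hne' : a' i ≠ a' j := fun h => hij (ha (le_antisymm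
      ((ha' i j).1 h.le) ((ha' j i).1 h.ge)))
    by_cases hb : a' i ≤ a' j
    · exact h1 ((hlt _ _ hi hj (lt_of_le_of_ne hb hne')).1.1 hle)
    by_cases hb' : a' j ≤ a' i
    · exact h2 ((hlt _ _ hj hi (lt_of_le_of_ne hb' hne'.symm)).2.1 hle)
    · exact hperp _ _ hi hj hb hb' hle
  refine hne (hG.eq_top fun ι _ a b ha hb => ?_)
  obtain ⟨a', haa', ha'⟩ := hanti ι a ha
  obtain ⟨b', hbb', hb'⟩ := hanti ι b hb
  exact haa'.trans ((hH.tupleSim hAut fun i j => by rw [ha', hb']).trans hbb'.symm)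

/-- Every injective tuple split by a lower set `S` is equivalent under `G` to one where the order
on `S` is kept, the order on the complement is reversed, and the elements of `S` are below
(if `p`) and above (if `q`) those of the complement. -/
def Flips (G : Subgroup (Equiv.Perm P)) (p q : Prop) : Prop :=
  ∀ (ι : Type) [Finite ι] (a : ι → P), Function.Injective a → ∀ S : Set ι,
    (∀ i j, a i ≤ a j → j ∈ S → i ∈ S) →
    ∃ b, TupleSim G a b ∧ (∀ i ∈ S, ∀ j ∈ S, (b i ≤ b j ↔ a i ≤ a j)) ∧
      (∀ i ∉ S, ∀ j ∉ S, (b i ≤ b j ↔ a j ≤ a i)) ∧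
      ∀ i ∈ S, ∀ j ∉ S, (b i ≤ b j ↔ p) ∧ (b j ≤ b i ↔ q)

theorem Flips.congr {G : Subgroup (Equiv.Perm P)} {p q p' q' : Prop} (h : Flips G p q)
    (hp : p ↔ p') (hq : q ↔ q') : Flips G p' q' := by
  rwa [← propext hp, ← propext hq]

theorem Flips.below_of_above {G : Subgroup (Equiv.Perm P)} (h : Flips G False True) :
    Flips G True False := by
  intro ι _ a ha S hS
  obtain ⟨b, hab, hb1, hb2, hb3⟩ := h ι a ha S hS
  obtain ⟨d, hbd, hd1, hd2, hd3⟩ := h ι b (hab.injective ha) Sᶜ (by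
    intro i j hij hj hi
    exact (hb3 i hi j hj).1.1 hij)
  have had := hab.trans hbd
  obtain ⟨e, hde, he1, he2, he3⟩ := h ι d (had.injective ha) S (by
    intro i j hij hj
    by_contra hi
    exact (hd3 i hi j (by simpa using hj)).1.1 hij)
  have hae := had.trans hde
  obtain ⟨f, hef, -, hf2, -⟩ := h ι e (hae.injective ha) ∅ (by simp)
  refine ⟨f, hae.trans hef, fun i hi j hj => ?_, fun i hi j hj => ?_, fun i hi j hj => ⟨?_, ?_⟩⟩
  · rw [hf2 i (by simp) j (by simp), he1 j hj i hi,
      hd2 j (by simpa using hj) i (by simpa using hi), hb1 i hi j hj]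
  · rw [hf2 i (by simp) j (by simp), he2 j hj i hi, hd1 i hi j hj, hb2 i hi j hj]
  · rw [hf2 i (by simp) j (by simp), (he3 i hi j hj).2]
  · rw [hf2 j (by simp) i (by simp), (he3 i hi j hj).1]

theorem Flips.eq_top_of_below (hH : IsHomogeneous P) {G : Subgroup (Equiv.Perm P)}
    (hG : IsClosedSubgroup G) (hAut : ∀ f : Equiv.Perm P, IsOrderAuto f → f ∈ G)
    (h : Flips G True False) : G = ⊤ := by
  have key : ∀ (ι : Type) [Finite ι] (r : ι → ℕ), Function.Injective r → ∀ a : ι → P,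
      Function.Injective a → ∀ k : ℕ, ∃ b, TupleSim G a b ∧
        ∀ i j, r i < k → r i ≤ r j → b i ≤ b j := by
    intro ι _ r hr a ha k
    induction k with
    | zero => exact ⟨a, ⟨1, G.one_mem, by simp⟩, by simp⟩
    | succ k ih =>
      obtain ⟨b, hab, hb⟩ := ih
      by_cases ht : ∃ t, r t = k
      swap
      · push Not at ht
        exact ⟨b, hab, fun i j hi => hb i j (lt_of_le_of_ne (Nat.lt_succ_iff.1 hi) (ht i))⟩
      obtain ⟨t, ht⟩ := ht
      have hbi := hab.injective ha
      obtain ⟨d, hbd, hd1, hd2, hd3⟩ := h ι b hbi {i | ¬ b t ≤ b i}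
        (fun i j hij hj hi => hj (hi.trans hij))
      have hsmall : ∀ i, r i < k → ¬ b t ≤ b i := fun i hi hle => by
        have := hbi (hle.antisymm (hb i t hi (by omega)))
        subst this
        omega
      have hdt : ∀ i, d i ≤ d t := fun i => by
        have ht' : t ∉ {i | ¬ b t ≤ b i} := by simp
        by_cases hi : i ∈ {i | ¬ b t ≤ b i}
        · exact (hd3 i hi t ht').1.2 trivial
        · exact (hd2 i hi t ht').2 (not_not.1 hi)
      have hd : ∀ i j, r i < k → r i ≤ r j → d i ≤ d j := fun i j hi hij => by
        by_cases hj : j ∈ {i | ¬ b t ≤ b i}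
        · exact (hd1 i (hsmall i hi) j hj).2 (hb i j hi hij)
        · exact (hd3 i (hsmall i hi) j hj).1.2 trivial
      have had := hab.trans hbd
      obtain ⟨e, hde, he1, he2, he3⟩ := h ι d (had.injective ha) {i | r i < k} (by
        intro i j hij hj
        by_contra hi
        have hji : r j ≤ r i := by
          simp only [Set.mem_ofPred_eq] at hi hj
          omega
        have := had.injective ha (hij.antisymm (hd j i hj hji))
        subst this
        exact hi hj)
      refine ⟨e, had.trans hde, fun i j hi hij => ?_⟩
      by_cases hik : r i < k
      · by_cases hjk : r j < k
        · exact (he1 i hik j hjk).2 (hd i j hik hij)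
        · exact (he3 i hik j hjk).1.2 trivial
      · have hit : i = t := hr (by omega)
        subst hit
        exact (he2 i hik j (by simp only [Set.mem_ofPred_eq]; omega)).2 (hdt j)
  refine hG.eq_top fun ι _ a b ha hb => ?_
  have := Fintype.ofFinite ι
  let r : ι → ℕ := fun i => Fintype.equivFin ι i
  have hr : Function.Injective r := Fin.val_injective.comp (Fintype.equivFin ι).injective
  have hrk : ∀ i, r i < Fintype.card ι := fun i => (Fintype.equivFin ι i).2
  have hlin : ∀ d : ι → P, Function.Injective d → ∃ d', TupleSim G d d' ∧
      ∀ i j, d' i ≤ d' j ↔ r i ≤ r j := fun d hd => by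
    obtain ⟨d', hdd', hd'⟩ := key ι r hr d hd (Fintype.card ι)
    refine ⟨d', hdd', fun i j => ⟨fun hij => ?_, hd' i j (hrk i)⟩⟩
    by_contra hlt
    have := hdd'.injective hd (hij.antisymm (hd' j i (hrk j) (by omega)))
    subst this
    exact hlt le_rfl
  obtain ⟨a', haa', ha'⟩ := hlin a ha
  obtain ⟨b', hbb', hb'⟩ := hlin b hb
  exact haa'.trans ((hH.tupleSim hAut fun i j => by rw [ha', hb']).trans hbb'.symm)

theorem Flips.eq_top_of_perp (hH : IsHomogeneous P) {G : Subgroup (Equiv.Perm P)}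
    (hG : IsClosedSubgroup G) (hAut : ∀ f : Equiv.Perm P, IsOrderAuto f → f ∈ G)
    (h : Flips G False False) : G = ⊤ := by
  have key : ∀ (ι : Type) [Finite ι] (a : ι → P), Function.Injective a → ∀ T : Finset ι,
      ∃ b, TupleSim G a b ∧ ∀ i ∈ T, ∀ j, (b i ≤ b j → i = j) ∧ (b j ≤ b i → i = j) := by
    classical
    intro ι _ a ha T
    induction T using Finset.induction_on with
    | empty => exact ⟨a, ⟨1, G.one_mem, by simp⟩, by simp⟩
    | insert t T htT ih =>
      obtain ⟨b, hab, hb⟩ := ih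
      have hbi := hab.injective ha
      obtain ⟨d, hbd, hd1, hd2, hd3⟩ := h ι b hbi {i | ¬ b t ≤ b i}
        (fun i j hij hj hi => hj (hi.trans hij))
      have ht' : t ∉ {i | ¬ b t ≤ b i} := by simp
      have hTS : ∀ i ∈ T, i ∈ {i | ¬ b t ≤ b i} := fun i hi hle => by
        have := (hb i hi t).2 hle
        subst this
        exact htT hi
      have hdt : ∀ i, d t ≤ d i → i = t := fun i hle => by
        by_cases hi : i ∈ {i | ¬ b t ≤ b i}
        · exact ((hd3 i hi t ht').2.1 hle).elim
        · exact hbi (((hd2 t ht' i hi).1 hle).antisymm (not_not.1 hi))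
      have hd : ∀ i ∈ T, ∀ j, (d i ≤ d j → i = j) ∧ (d j ≤ d i → i = j) := fun i hi j => by
        have hiS := hTS i hi
        by_cases hj : j ∈ {i | ¬ b t ≤ b i}
        · exact ⟨fun hle => (hb i hi j).1 ((hd1 i hiS j hj).1 hle),
            fun hle => (hb i hi j).2 ((hd1 j hj i hiS).1 hle)⟩
        · exact ⟨fun hle => ((hd3 i hiS j hj).1.1 hle).elim,
            fun hle => ((hd3 i hiS j hj).2.1 hle).elim⟩
      have had := hab.trans hbd
      obtain ⟨e, hde, he1, -, he3⟩ := h ι d (had.injective ha) {i | i ≠ t} (by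
        rintro i j hij hj rfl
        exact hj (hdt j hij))
      refine ⟨e, had.trans hde, fun i hi j => ?_⟩
      by_cases hit : i = t
      · subst hit
        by_cases hji : j = i
        · exact ⟨fun _ => hji.symm, fun _ => hji.symm⟩
        · exact ⟨fun hle => ((he3 j hji i (by simp)).2.1 hle).elim,
            fun hle => ((he3 j hji i (by simp)).1.1 hle).elim⟩
      · have hiT : i ∈ T := (Finset.mem_insert.1 hi).resolve_left hit
        by_cases hjt : j = t
        · subst hjt
          exact ⟨fun hle => ((he3 i hit j (by simp)).1.1 hle).elim,
            fun hle => ((he3 i hit j (by simp)).2.1 hle).elim⟩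
        · exact ⟨fun hle => (hd i hiT j).1 ((he1 i hit j hjt).1 hle),
            fun hle => (hd i hiT j).2 ((he1 j hjt i hit).1 hle)⟩
  refine hG.eq_top fun ι _ a b ha hb => ?_
  have := Fintype.ofFinite ι
  have hanti : ∀ d : ι → P, Function.Injective d → ∃ d', TupleSim G d d' ∧
      ∀ i j, d' i ≤ d' j ↔ i = j := fun d hd => by
    obtain ⟨d', hdd', hd'⟩ := key ι d hd Finset.univ
    exact ⟨d', hdd', fun i j => ⟨(hd' i (Finset.mem_univ i) j).1, fun h => h ▸ le_rfl⟩⟩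
  obtain ⟨a', haa', ha'⟩ := hanti a ha
  obtain ⟨b', hbb', hb'⟩ := hanti b hb
  exact haa'.trans ((hH.tupleSim hAut fun i j => by rw [ha', hb']).trans hbb'.symm)

theorem Flips.eq_top (hU : IsUniversal P) (hH : IsHomogeneous P) {G : Subgroup (Equiv.Perm P)}
    (hG : IsClosedSubgroup G) (hAut : ∀ f : Equiv.Perm P, IsOrderAuto f → f ∈ G)
    {p q : Prop} (h : Flips G p q) : G = ⊤ := by
  by_cases hp : p <;> by_cases hq : q
  · exfalso
    obtain ⟨e⟩ := hU Bool
    obtain ⟨b, hab, -, -, hb⟩ := h Bool e e.injective {i | i = false} (by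
      intro i j hij hj
      rw [e.le_iff_le] at hij
      simp only [Set.mem_ofPred_eq] at *
      subst hj
      exact le_bot_iff.1 hij)
    have h1 := hb false rfl true (by simp)
    exact absurd (hab.injective e.injective ((h1.1.2 hp).antisymm (h1.2.2 hq))) (by decide)
  · exact (h.congr (iff_true_intro hp) (iff_false_intro hq)).eq_top_of_below hH hG hAut
  · exact (h.congr (iff_false_intro hp) (iff_true_intro hq)).below_of_above.eq_top_of_below
      hH hG hAut
  · exact (h.congr (iff_false_intro hp) (iff_false_intro hq)).eq_top_of_perp hH hG hAut

/-- A rule that keeps the order on a lower set `S`, reverses it on the complement, and sends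
each of the two possible relations between `S` and its complement to a fixed relation, must treat
these two relations alike. -/
theorem eq_top_of_mixed_rule (hU : IsUniversal P) (hH : IsHomogeneous P)
    {G : Subgroup (Equiv.Perm P)}
    (hG : IsClosedSubgroup G) (hAut : ∀ f : Equiv.Perm P, IsOrderAuto f → f ∈ G)
    {p q p' q' : Prop}
    (h : ∀ (ι : Type) [Finite ι] (a : ι → P), Function.Injective a → ∀ S : Set ι,
      (∀ i j, a i ≤ a j → j ∈ S → i ∈ S) →
      ∃ b, TupleSim G a b ∧ (∀ i ∈ S, ∀ j ∈ S, (b i ≤ b j ↔ a i ≤ a j)) ∧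
        (∀ i ∉ S, ∀ j ∉ S, (b i ≤ b j ↔ a j ≤ a i)) ∧
        ∀ i ∈ S, ∀ j ∉ S, (a i ≤ a j → (b i ≤ b j ↔ p) ∧ (b j ≤ b i ↔ q)) ∧
          (¬ a i ≤ a j → (b i ≤ b j ↔ p') ∧ (b j ≤ b i ↔ q'))) : G = ⊤ := by
  obtain ⟨e⟩ := hU (Bool × Bool)
  obtain ⟨b, -, hb1, hb2, hb3⟩ := h (Bool × Bool) e e.injective {i | i.1 = false} (by
    rintro ⟨i, i'⟩ ⟨j, j'⟩ hij hj
    rw [e.le_iff_le] at hij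
    simp only [Set.mem_ofPred_eq] at *
    subst hj
    exact le_bot_iff.1 hij.1)
  have hx := (hb1 (false, false) rfl (false, true) rfl).2 (e.le_iff_le.2 (by decide))
  have hy := (hb2 (true, true) (by simp) (true, false) (by simp)).2 (e.le_iff_le.2 (by decide))
  have h00 := (hb3 (false, false) rfl (true, false) (by simp)).1 (e.le_iff_le.2 (by decide))
  have h10 := (hb3 (false, true) rfl (true, false) (by simp)).2
    (fun hle => absurd (e.le_iff_le.1 hle) (by decide))
  have h11 := (hb3 (false, true) rfl (true, true) (by simp)).1 (e.le_iff_le.2 (by decide))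
  have hp : p ↔ p' :=
    ⟨fun hp => h10.1.1 ((h11.1.2 hp).trans hy), fun hp => h00.1.1 (hx.trans (h10.1.2 hp))⟩
  have hq : q ↔ q' :=
    ⟨fun hq => h10.2.1 ((h00.2.2 hq).trans hx), fun hq => h11.2.1 (hy.trans (h10.2.2 hq))⟩
  have hF : Flips G p q := by
    intro ι _ a ha S hS
    obtain ⟨b, hab, h1, h2, h3⟩ := h ι a ha S hS
    refine ⟨b, hab, h1, h2, fun i hi j hj => ?_⟩
    by_cases hij : a i ≤ a j
    · exact (h3 i hi j hj).1 hij
    · have := (h3 i hi j hj).2 hij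
      rwa [← hp, ← hq] at this
  exact hF.eq_top hU hH hG hAut

/-- An element of one type lies above an element of a separated type only if the types agree. -/
theorem Separated.sameType_of_le {n : ℕ} {c : Fin n → P} {u v x y : P} (huv : Separated c u v)
    (hx : SameType c x u) (hy : SameType c y v) (hyx : y ≤ x) : SameType c u v := by
  refine fun k => ⟨⟨huv.le_right k, fun h => ?_⟩, ⟨fun h => ?_, huv.left_le k⟩⟩
  · exact (hx k).1.1 (((hy k).1.2 h).trans hyx)
  · exact (hy k).2.1 (hyx.trans ((hx k).2.2 h))

theorem not_idOnType_and_revOnType (hU : IsUniversal P) (hH : IsHomogeneous P) {n : ℕ}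
    {c : Fin n → P} {g : P → P} {u v : P} (hu : ∀ k, u ≠ c k) (huv : SameType c u v)
    (h1 : IdOnType c g u) (h2 : RevOnType c g v) : False := by
  obtain ⟨x, y, hx, hy, hxy⟩ := exists_lt_of_sameType hU hH hu
  exact hxy.not_ge ((h2 x y (hx.trans huv) (hy.trans huv)).1 ((h1 x y hx hy).2 hxy.le))

/-- For separated types realized in both possible ways, the relation between images is determined
by the relation between arguments. -/
theorem Separated.exists_between {n : ℕ} {c : Fin n → P} {u v : P} {g : P → P}
    (huv : Separated c u v) (hH : IsHomogeneous P) (hcan : Canonical n c g)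
    (hne : ¬ SameType c u v) :
    ∃ p q p' q' : Prop, ∀ x y, SameType c x u → SameType c y v →
      (x ≤ y → (g x ≤ g y ↔ p) ∧ (g y ≤ g x ↔ q)) ∧
      (¬ x ≤ y → (g x ≤ g y ↔ p') ∧ (g y ≤ g x ↔ q')) := by
  have hnle : ∀ x y, SameType c x u → SameType c y v → ¬ y ≤ x := fun x y hx hy h =>
    hne (huv.sameType_of_le hx hy h)
  refine ⟨∃ x y, SameType c x u ∧ SameType c y v ∧ x ≤ y ∧ g x ≤ g y,
    ∃ x y, SameType c x u ∧ SameType c y v ∧ x ≤ y ∧ g y ≤ g x,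
    ∃ x y, SameType c x u ∧ SameType c y v ∧ ¬ x ≤ y ∧ g x ≤ g y,
    ∃ x y, SameType c x u ∧ SameType c y v ∧ ¬ x ≤ y ∧ g y ≤ g x, fun x y hx hy => ?_⟩
  have key : ∀ x' y', SameType c x' u → SameType c y' v → (x ≤ y ↔ x' ≤ y') →
      (g x ≤ g y ↔ g x' ≤ g y') ∧ (g y ≤ g x ↔ g y' ≤ g x') := fun x' y' hx' hy' h =>
    hcan.le_iff hH (hx.trans hx'.symm) (hy.trans hy'.symm) h
      (iff_of_false (hnle x y hx hy) (hnle x' y' hx' hy'))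
  refine ⟨fun hxy => ⟨⟨fun h => ⟨x, y, hx, hy, hxy, h⟩, ?_⟩,
    ⟨fun h => ⟨x, y, hx, hy, hxy, h⟩, ?_⟩⟩, fun hxy => ⟨⟨fun h => ⟨x, y, hx, hy, hxy, h⟩, ?_⟩,
    ⟨fun h => ⟨x, y, hx, hy, hxy, h⟩, ?_⟩⟩⟩ <;> rintro ⟨x', y', hx', hy', hxy', h⟩
  · exact (key x' y' hx' hy' (iff_of_true hxy hxy')).1.2 h
  · exact (key x' y' hx' hy' (iff_of_true hxy hxy')).2.2 h
  · exact (key x' y' hx' hy' (iff_of_false hxy hxy')).1.2 h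
  · exact (key x' y' hx' hy' (iff_of_false hxy hxy')).2.2 h

/-- If `g` reverses the order on some type, then every tuple is equivalent to its reversal. -/
theorem RevOnType.exists_reversal (hU : IsUniversal P) (hH : IsHomogeneous P)
    {G : Subgroup (Equiv.Perm P)} (hAut : ∀ f : Equiv.Perm P, IsOrderAuto f → f ∈ G) {n : ℕ}
    {c : Fin n → P} {g : P → P} (hM : MGen G g) {u : P} (hu : ∀ k, u ≠ c k)
    (h : RevOnType c g u) {ι : Type} [Finite ι] (a : ι → P) :
    ∃ b, TupleSim G a b ∧ ∀ i j, b i ≤ b j ↔ a j ≤ a i := by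
  obtain ⟨a', ha', haS, -⟩ := (Separated.refl hu).exists_tuple hU hH a Set.univ (by simp)
  exact ⟨g ∘ a', (hH.tupleSim hAut fun i j => (ha' i j).symm).trans (hM.tupleSim a'),
    fun i j => (h _ _ (haS i trivial) (haS j trivial)).trans (ha' j i)⟩

/-- Separated types are treated in the same way by `g`, unless `G` is the full symmetric group. -/
theorem Separated.idOnType_iff (hU : IsUniversal P) (hH : IsHomogeneous P)
    {G : Subgroup (Equiv.Perm P)} (hG : IsClosedSubgroup G)
    (hAut : ∀ f : Equiv.Perm P, IsOrderAuto f → f ∈ G) {n : ℕ} {c : Fin n → P} {g : P → P}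
    (hcan : Canonical n c g) (hM : MGen G g) (hne : G ≠ ⊤) {u v : P} (huv : Separated c u v) :
    IdOnType c g u ↔ IdOnType c g v := by
  constructor
  · intro hid
    refine (idOnType_or_revOnType hU hH hG hAut hcan hM hne huv.right_ne).resolve_right
      fun hrev => ?_
    have hst : ¬ SameType c u v := fun h =>
      not_idOnType_and_revOnType hU hH huv.left_ne h hid hrev
    obtain ⟨p, q, p', q', hpq⟩ := huv.exists_between hH hcan hst
    refine hne (eq_top_of_mixed_rule hU hH hG hAut (p := p) (q := q) (p' := p') (q' := q') ?_)
    intro ι _ a ha S hS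
    obtain ⟨a', h1, h2, h3⟩ := huv.exists_tuple hU hH a S hS
    refine ⟨g ∘ a', (hH.tupleSim hAut fun i j => (h1 i j).symm).trans (hM.tupleSim a'),
      fun i hi j hj => (hid _ _ (h2 i hi) (h2 j hj)).trans (h1 i j),
      fun i hi j hj => (hrev _ _ (h3 i hi) (h3 j hj)).trans (h1 j i), fun i hi j hj => ?_⟩
    rw [← h1]
    exact hpq _ _ (h2 i hi) (h3 j hj)
  · intro hid
    refine (idOnType_or_revOnType hU hH hG hAut hcan hM hne huv.left_ne).resolve_right
      fun hrev => ?_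
    have hst : ¬ SameType c u v := fun h =>
      not_idOnType_and_revOnType hU hH huv.right_ne h.symm hid hrev
    obtain ⟨p, q, p', q', hpq⟩ := huv.exists_between hH hcan hst
    refine hne (eq_top_of_mixed_rule hU hH hG hAut (p := q) (q := p) (p' := q') (q' := p') ?_)
    intro ι _ a ha S hS
    obtain ⟨a', h1, h2, h3⟩ := huv.exists_tuple hU hH a S hS
    obtain ⟨b, hb, hbr⟩ := hrev.exists_reversal hU hH hAut hM huv.left_ne (g ∘ a')
    refine ⟨b, ((hH.tupleSim hAut fun i j => (h1 i j).symm).trans (hM.tupleSim a')).trans hb,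
      fun i hi j hj => (hbr i j).trans ((hrev _ _ (h2 j hj) (h2 i hi)).trans (h1 i j)),
      fun i hi j hj => (hbr i j).trans ((hid _ _ (h3 j hj) (h3 i hi)).trans (h1 j i)),
      fun i hi j hj => ?_⟩
    have := hpq _ _ (h2 i hi) (h3 j hj)
    rw [← h1, hbr, hbr]
    exact ⟨fun h => (this.1 h).symm, fun h => (this.2 h).symm⟩

/-- Non-constant elements of an infinite orbit have the same type over the constants. -/
theorem IsOrbit.exists_sameType {n : ℕ} {c : Fin n → P} {X : Set P} (hX : IsOrbit n c X)
    (hinf : X.Infinite) : ∃ u, (∀ k, u ≠ c k) ∧ ∀ x ∈ X, SameType c x u := by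
  obtain ⟨u, rfl⟩ := hX
  refine ⟨u, ?_, ?_⟩
  · rintro k rfl
    refine hinf ((Set.finite_singleton (c k)).subset ?_)
    rintro _ ⟨h, hh, rfl⟩
    exact hh.2 k
  · rintro _ ⟨h, hh, rfl⟩ k
    constructor
    · conv_lhs => rw [← hh.2 k]
      exact hh.1 _ _
    · conv_lhs => rw [← hh.2 k]
      exact hh.1 _ _

theorem IdOnType.behavesLikeId {n : ℕ} {c : Fin n → P} {g : P → P} {u : P}
    (h : IdOnType c g u) {X : Set P} (hX : ∀ x ∈ X, SameType c x u) : BehavesLikeId g X := by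
  intro x hx y hy
  have h1 := h x y (hX x hx) (hX y hy)
  have h2 := h y x (hX y hy) (hX x hx)
  simp only [lt_iff_le_not_ge, Perp, h1, h2, imp_self, and_self]

theorem RevOnType.behavesLikeRev {n : ℕ} {c : Fin n → P} {g : P → P} {u : P}
    (h : RevOnType c g u) {X : Set P} (hX : ∀ x ∈ X, SameType c x u) : BehavesLikeRev g X := by
  intro x hx y hy
  have h1 := h x y (hX x hx) (hX y hy)
  have h2 := h y x (hX y hy) (hX x hx)
  simp only [lt_iff_le_not_ge, Perp, h1, h2, imp_self, true_and]
  exact And.symm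

/-- A canonical function M-generated by `𝒢` behaves like `id` on all infinite orbits,
or like `↕` on all infinite orbits, unless `𝒢 = Sym(P)`. -/
theorem canonical_same_behavior_on_all_orbits [Countable P] [Infinite P]
    (hU : IsUniversal P) (hH : IsHomogeneous P)
    (G : Subgroup (Equiv.Perm P)) (hG : IsClosedSubgroup G)
    (hAut : ∀ f : Equiv.Perm P, IsOrderAuto f → f ∈ G)
    (n : ℕ) (c : Fin n → P) (g : P → P)
    (hcan : Canonical n c g) (hM : MGen G g) :
    G = ⊤ ∨
      (∀ X : Set P, IsOrbit n c X → X.Infinite → BehavesLikeId g X) ∨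
      (∀ X : Set P, IsOrbit n c X → X.Infinite → BehavesLikeRev g X) := by
  by_cases hne : G = ⊤
  · exact Or.inl hne
  right
  obtain ⟨w, -, hw1, hw2⟩ := exists_realization hU hH c (ι := Unit) (fun _ _ => False)
    (fun _ _ => False) (by simp) (by simp) (by simp) (by simp) (by simp) (by simp)
  have hiff : ∀ u, (∀ k, u ≠ c k) → (IdOnType c g u ↔ IdOnType c g (w ())) := by
    intro u hu
    obtain ⟨v, -, hv1, hv2⟩ := exists_realization hU hH c (ι := Unit) (fun _ _ => False)
      (fun _ k => u ≤ c k) (by simp) (fun _ k l h h' => h'.trans h) (by simp) (by simp)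
      (fun _ _ k _ h => h) (by simp)
    have hvc : ∀ k, v () ≠ c k := fun k h => (hv1 () k).1 h.ge
    have h1 : Separated c (v ()) u :=
      ⟨hvc, hu, fun k h => ((hv1 () k).1 h).elim, fun k h => (hv2 () k).2 h,
        fun k h h' => hu k (((hv2 () k).1 h).antisymm h')⟩
    have h2 : Separated c (v ()) (w ()) :=
      ⟨hvc, fun k h => (hw1 () k).1 h.ge, fun k h => ((hv1 () k).1 h).elim,
        fun k h => ((hw2 () k).1 h).elim, fun k _ h => (hw1 () k).1 h⟩
    exact (h1.idOnType_iff hU hH hG hAut hcan hM hne).symm.trans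
      (h2.idOnType_iff hU hH hG hAut hcan hM hne)
  by_cases hid : IdOnType c g (w ())
  · left
    intro X hX hinf
    obtain ⟨u, hu, hXu⟩ := hX.exists_sameType hinf
    exact ((hiff u hu).2 hid).behavesLikeId hXu
  · right
    intro X hX hinf
    obtain ⟨u, hu, hXu⟩ := hX.exists_sameType hinf
    exact ((idOnType_or_revOnType hU hH hG hAut hcan hM hne hu).resolve_left
      fun h => hid ((hiff u hu).1 h)).behavesLikeRev hXu
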